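/- With u harmonic and φ as above, define E_φ(x,r) := -∫ |∂_{ν_x} u(y)|² |y-x| φ'(|y-x|/r) dy where ν_x(y) = (y-x)/|y-x|. Then the Cauchy–Schwarz inequality gives (r D_φ(x,r))² ≤ H_φ(x,r) E_φ(x,r), using the identity r D_φ(x,r) = -∫ φ'(|y-x|/r) ∂_{ν_x}u(y)·u(y) dy. -/

import Mathlib

open Metric MeasureTheory

lemma aux_deriv_low (φ : ℝ → ℝ) (hmono : Antitone φ)
    (hone : ∀ t : ℝ, 0 ≤ t → t ≤ 1 / 2 → φ t = 1)
    (hrange : ∀ t : ℝ, φ t ∈ Set.Icc (0 : ℝ) 1) (t : ℝ) (ht : t < 1/2) : deriv φ t = 0 := by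
  have : φ =ᶠ[nhds t] fun _ => (1:ℝ) := by
    filter_upwards [Iio_mem_nhds ht] with s hs
    rcases le_or_gt 0 s with h | h
    · exact hone s h (le_of_lt hs)
    · apply le_antisymm (hrange s).2
      rw [← hone 0 le_rfl (by norm_num)]
      exact hmono h.le
  rw [this.deriv_eq]; simp

lemma aux_deriv_high (φ : ℝ → ℝ) 
    (hzero : ∀ t : ℝ, 1 ≤ t → φ t = 0) (t : ℝ) (ht : 1 < t) : deriv φ t = 0 := by
  have : φ =ᶠ[nhds t] fun _ => (0:ℝ) := by
    filter_upwards [Ioi_mem_nhds ht] with s hs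
    exact hzero s (le_of_lt hs)
  rw [this.deriv_eq]; simp

lemma aux_integrable {m : ℕ} (φ : ℝ → ℝ) (K : NNReal) (hlip : LipschitzWith K φ)
    (hmono : Antitone φ)
    (hone : ∀ t : ℝ, 0 ≤ t → t ≤ 1 / 2 → φ t = 1)
    (hzero : ∀ t : ℝ, 1 ≤ t → φ t = 0)
    (hrange : ∀ t : ℝ, φ t ∈ Set.Icc (0 : ℝ) 1)
    (x : EuclideanSpace ℝ (Fin m)) (r : ℝ) (hr : 0 < r)
    (F : EuclideanSpace ℝ (Fin m) → ℝ)
    (hF : ContinuousOn F (closedBall x r \ {x})) :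
    Integrable (fun y => F y * deriv φ (‖y - x‖ / r)) := by
  have hA : IsCompact (closedBall x r \ ball x (r/2)) :=
    (isCompact_closedBall x r).diff isOpen_ball
  have hF' : IntegrableOn F (closedBall x r \ ball x (r/2)) := by
    apply ContinuousOn.integrableOn_compact hA
    apply hF.mono
    intro y hy
    refine ⟨hy.1, ?_⟩
    rintro rfl
    exact hy.2 (mem_ball_self (by positivity))
  have : IntegrableOn (fun y => F y * deriv φ (‖y - x‖ / r)) (closedBall x r \ ball x (r/2)) := by
    apply Integrable.mul_bdd (c := (K:ℝ)) hF'
    · apply Measurable.aestronglyMeasurable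
      exact (measurable_deriv φ).comp (by fun_prop)
    · exact Filter.Eventually.of_forall fun y => norm_deriv_le_of_lipschitz hlip
  apply this.integrable_of_forall_notMem_eq_zero
  intro y hy
  have : deriv φ (‖y - x‖ / r) = 0 := by
    rcases lt_or_ge (‖y - x‖ / r) (1/2) with h | h
    · exact aux_deriv_low φ hmono hone hrange _ h
    · apply aux_deriv_high φ hzero
      by_contra hc
      apply hy
      rw [not_lt, div_le_one hr] at hc
      rw [le_div_iff₀ hr] at h
      refine ⟨by simpa [dist_eq_norm] using hc, ?_⟩
      simp [dist_eq_norm]; linarith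
  rw [this, mul_zero]

lemma aux_integrable' {m : ℕ} (φ : ℝ → ℝ) (K : NNReal) (hlip : LipschitzWith K φ)
    (hzero : ∀ t : ℝ, 1 ≤ t → φ t = 0)
    (x : EuclideanSpace ℝ (Fin m)) (r : ℝ) (hr : 0 < r)
    (F : EuclideanSpace ℝ (Fin m) → ℝ)
    (hF : ContinuousOn F (closedBall x r)) :
    Integrable (fun y => F y * φ (‖y - x‖ / r)) := by
  have : IntegrableOn (fun y => F y * φ (‖y - x‖ / r)) (closedBall x r) := by
    apply ContinuousOn.integrableOn_compact (isCompact_closedBall x r)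
    apply hF.mul
    exact (hlip.continuous.comp (by fun_prop)).continuousOn
  apply this.integrable_of_forall_notMem_eq_zero
  intro y hy
  rw [hzero, mul_zero]
  rw [le_div_iff₀ hr]
  simp [dist_eq_norm] at hy
  linarith

lemma aux_opnorm {m n : ℕ} (L : EuclideanSpace ℝ (Fin m) →L[ℝ] EuclideanSpace ℝ (Fin n)) :
    ‖L‖ ^ 2 ≤ ∑ i : Fin m, ‖L (EuclideanSpace.single i 1)‖ ^ 2 := by
  have h0 : 0 ≤ ∑ i : Fin m, ‖L (EuclideanSpace.single i 1)‖ ^ 2 := by positivity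
  have : ‖L‖ ≤ √(∑ i : Fin m, ‖L (EuclideanSpace.single i 1)‖ ^ 2) := by
    apply L.opNorm_le_bound (Real.sqrt_nonneg _)
    intro v
    have hv : v = ∑ i : Fin m, v i • EuclideanSpace.single i (1:ℝ) := by
      ext j; simp [Pi.single_apply]
    conv_lhs => rw [hv]
    rw [map_sum]
    refine (norm_sum_le _ _).trans ?_
    simp only [map_smul, norm_smul]
    rw [EuclideanSpace.norm_eq, mul_comm]
    exact Real.sum_mul_le_sqrt_mul_sqrt _ _ _
  calc ‖L‖^2 ≤ (√(∑ i : Fin m, ‖L (EuclideanSpace.single i 1)‖ ^ 2))^2 := by gcongr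
    _ = _ := Real.sq_sqrt h0

lemma aux_psi {m : ℕ} (φ : ℝ → ℝ) (hmono : Antitone φ)
    (hone : ∀ t : ℝ, 0 ≤ t → t ≤ 1 / 2 → φ t = 1)
    (hrange : ∀ t : ℝ, φ t ∈ Set.Icc (0 : ℝ) 1)
    (x : EuclideanSpace ℝ (Fin m)) (r : ℝ) (hr : 0 < r) (y v : EuclideanSpace ℝ (Fin m))
    (hd : DifferentiableAt ℝ (fun y => φ (‖y - x‖ / r)) y) :
    lineDeriv ℝ (fun y => φ (‖y - x‖ / r)) y v =
      r⁻¹ * (‖y - x‖⁻¹ * inner ℝ (y - x) v) * deriv φ (‖y - x‖ / r) := by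
  rw [hd.lineDeriv_eq_fderiv]
  by_cases hy : y = x
  · subst hy
    have : (fun z => φ (‖z - y‖ / r)) =ᶠ[nhds y] fun _ => (1:ℝ) := by
      filter_upwards [ball_mem_nhds y (show 0 < r/2 by positivity)] with s hs
      apply hone _ (by positivity)
      rw [div_le_iff₀ hr]
      rw [mem_ball, dist_eq_norm] at hs
      linarith
    rw [this.fderiv_eq]
    simp
  · have hy' : y - x ≠ 0 := sub_ne_zero.2 hy
    have hn : 0 < ‖y - x‖ := norm_pos_iff.2 hy'
    have hφ : DifferentiableAt ℝ φ (‖y - x‖ / r) := by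
      have h1 : DifferentiableAt ℝ (fun s : ℝ => x + (s * r / ‖y - x‖) • (y - x)) (‖y - x‖ / r) := by
        fun_prop
      have h2 : x + ((‖y - x‖ / r) * r / ‖y - x‖) • (y - x) = y := by
        have : ((‖y - x‖ / r) * r / ‖y - x‖) = 1 := by field_simp
        rw [this]; simp
      have h3 := DifferentiableAt.comp (𝕜 := ℝ) (g := fun y => φ (‖y - x‖ / r)) (‖y - x‖ / r)
        (by rw [h2]; exact hd) h1
      refine h3.congr_of_eventuallyEq ?_
      filter_upwards [Ioi_mem_nhds (show 0 < ‖y - x‖ / r by positivity)] with s hs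
      have hs' : 0 < s := hs
      simp only [Function.comp]
      congr 1
      rw [add_sub_cancel_left, norm_smul, Real.norm_of_nonneg (by positivity)]
      field_simp
    have hN : HasFDerivAt (fun y => ‖y - x‖ / r) (r⁻¹ • (‖y - x‖⁻¹ • innerSL ℝ (y - x))) y := by
      have h1 : HasFDerivAt (fun y : EuclideanSpace ℝ (Fin m) => ‖y - x‖ ^ 2)
          (2 • innerSL ℝ (y - x)) y := by
        have := (hasFDerivAt_id (𝕜 := ℝ) y).sub_const x |>.norm_sq
        simpa using this
      have h2 := h1.sqrt (by positivity)
      have h3 : (fun y : EuclideanSpace ℝ (Fin m) => √(‖y - x‖ ^ 2)) = fun y => ‖y - x‖ := by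
        ext z; exact Real.sqrt_sq (norm_nonneg _)
      rw [h3, Real.sqrt_sq hn.le] at h2
      have h4 := h2.mul_const r⁻¹
      simp only [← div_eq_mul_inv] at h4
      refine h4.congr_fderiv ?_
      ext w; simp; left; ring
    have := (hφ.hasDerivAt.comp_hasFDerivAt y hN).fderiv
    simp only [Function.comp_def] at this
    rw [this]
    simp only [ContinuousLinearMap.smul_apply, innerSL_apply_apply, smul_eq_mul]
    ring

lemma aux_parts {m : ℕ} (φ : ℝ → ℝ) (K : NNReal) (hlip : LipschitzWith K φ)
    (hmono : Antitone φ)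
    (hone : ∀ t : ℝ, 0 ≤ t → t ≤ 1 / 2 → φ t = 1)
    (hzero : ∀ t : ℝ, 1 ≤ t → φ t = 0)
    (hrange : ∀ t : ℝ, φ t ∈ Set.Icc (0 : ℝ) 1)
    (Ω : Set (EuclideanSpace ℝ (Fin m))) (hΩ : IsOpen Ω)
    (x : EuclideanSpace ℝ (Fin m)) (r : ℝ) (hr : 0 < r) (hball : closedBall x r ⊆ Ω)
    (G : EuclideanSpace ℝ (Fin m) → ℝ) (hG : ContDiffOn ℝ 1 G Ω) (v : EuclideanSpace ℝ (Fin m)) :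
    ∫ y, (r⁻¹ * (‖y - x‖⁻¹ * inner ℝ (y - x) v) * G y) * deriv φ (‖y - x‖ / r)
      = - ∫ y, fderiv ℝ G y v * φ (‖y - x‖ / r) := by
  obtain ⟨δ, hδ, hsub⟩ := (isCompact_closedBall x r).exists_cthickening_subset_open hΩ hball
  rw [cthickening_closedBall hδ.le hr.le] at hsub
  let η : ContDiffBump x := ⟨r, δ + r, hr, by linarith⟩
  have hηs : tsupport η ⊆ Ω := by
    rw [η.tsupport_eq]
    refine subset_trans ?_ hsub
    exact closedBall_subset_closedBall (by simp [η, add_comm])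
  have hη1 : ∀ y, ‖y - x‖ ≤ r → η y = 1 := by
    intro y hy
    apply η.one_of_mem_closedBall
    simpa [dist_eq_norm, η] using hy
  have hg : ContDiff ℝ 1 (fun y => η y * G y) := by
    rw [contDiff_iff_contDiffAt]
    intro y
    by_cases hy : y ∈ Ω
    · exact (η.contDiff.contDiffAt).mul (hG.contDiffAt (hΩ.mem_nhds hy))
    · have h1 : y ∉ tsupport η := fun h => hy (hηs h)
      have h2 := notMem_tsupport_iff_eventuallyEq.1 h1
      have : (fun y => η y * G y) =ᶠ[nhds y] fun _ => (0:ℝ) := by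
        filter_upwards [h2] with z hz
        simp [hz]
      exact contDiffAt_const.congr_of_eventuallyEq this
  have hgc : HasCompactSupport (fun y => η y * G y) := η.hasCompactSupport.mul_right
  obtain ⟨C, hC⟩ := ContDiff.lipschitzWith_of_hasCompactSupport hgc hg (by simp)
  have hψ : LipschitzWith (K * ⟨r⁻¹, by positivity⟩) (fun y : EuclideanSpace ℝ (Fin m) => φ (‖y - x‖ / r)) := by
    apply hlip.comp
    apply LipschitzWith.of_dist_le_mul
    intro a b
    rw [Real.dist_eq, ← sub_div, abs_div, abs_of_pos hr, dist_eq_norm, div_eq_inv_mul]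
    have := abs_norm_sub_norm_le (a - x) (b - x)
    rw [sub_sub_sub_cancel_right] at this
    exact mul_le_mul_of_nonneg_left this (by positivity)
  have key := LipschitzWith.integral_lineDeriv_mul_eq (μ := volume) hψ hC hgc v
  have hl : ∫ y, (r⁻¹ * (‖y - x‖⁻¹ * inner ℝ (y - x) v) * G y) * deriv φ (‖y - x‖ / r)
      = ∫ y, lineDeriv ℝ (fun y => φ (‖y - x‖ / r)) y v * (η y * G y) := by
    apply integral_congr_ae
    filter_upwards [hψ.ae_differentiableAt] with y hy
    rw [aux_psi φ hmono hone hrange x r hr y v hy]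
    rcases le_or_gt ‖y - x‖ r with h | h
    · rw [hη1 y h]; ring
    · rw [aux_deriv_high φ hzero (‖y - x‖ / r) ((one_lt_div hr).2 h)]; ring
  rw [hl, key, ← integral_neg]
  congr 1
  ext y
  rcases lt_or_ge ‖y - x‖ r with h | h
  · have : (fun y => η y * G y) =ᶠ[nhds y] G := by
      have : y ∈ ball x r := by simpa [dist_eq_norm] using h
      filter_upwards [isOpen_ball.mem_nhds this] with z hz
      rw [hη1, one_mul]
      rw [mem_ball, dist_eq_norm] at hz
      exact hz.le
    rw [(hg.differentiable (by simp)).differentiableAt.lineDeriv_eq_fderiv, this.fderiv_eq]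
    simp
  · rw [hzero _ ((one_le_div hr).2 h)]; simp

/-- For a smooth harmonic `u` and a Lipschitz nonincreasing cut-off `φ`, with
`D_φ(x,r) = ∫ |Du(y)|² φ(|y-x|/r) dy`, `H_φ(x,r) = -∫ |u(y)|² |y-x|⁻¹ φ'(|y-x|/r) dy`, and
`E_φ(x,r) = -∫ |∂_{ν_x} u(y)|² |y-x| φ'(|y-x|/r) dy` where `ν_x(y) = (y-x)/|y-x|`, the
Cauchy–Schwarz inequality gives `(r D_φ(x,r))² ≤ H_φ(x,r) E_φ(x,r)`. -/
theorem stmt_8 {m n : ℕ}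
    (Ω : Set (EuclideanSpace ℝ (Fin m))) (hΩ : IsOpen Ω)
    (φ : ℝ → ℝ) (K : NNReal) (hlip : LipschitzWith K φ) (hmono : Antitone φ)
    (hone : ∀ t : ℝ, 0 ≤ t → t ≤ 1 / 2 → φ t = 1)
    (hzero : ∀ t : ℝ, 1 ≤ t → φ t = 0)
    (hrange : ∀ t : ℝ, φ t ∈ Set.Icc (0 : ℝ) 1)
    (u : EuclideanSpace ℝ (Fin m) → EuclideanSpace ℝ (Fin n))
    (hu : ContDiffOn ℝ (⊤ : ℕ∞) u Ω)
    (hharm : ∀ y ∈ Ω, ∑ i : Fin m,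
      iteratedFDeriv ℝ 2 u y ![EuclideanSpace.single i 1, EuclideanSpace.single i 1] = 0)
    (x : EuclideanSpace ℝ (Fin m)) (r : ℝ) (hr : 0 < r)
    (hball : closedBall x r ⊆ Ω)
    (D H E : ℝ)
    (hD : D = ∫ y, ‖fderiv ℝ u y‖ ^ 2 * φ (‖y - x‖ / r))
    (hH : H = -∫ y, ‖u y‖ ^ 2 * ‖y - x‖⁻¹ * deriv φ (‖y - x‖ / r))
    (hE : E = -∫ y, ‖fderiv ℝ u y (‖y - x‖⁻¹ • (y - x))‖ ^ 2 * ‖y - x‖ * deriv φ (‖y - x‖ / r)) :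
    (r * D) ^ 2 ≤ H * E := by
  have huy : ∀ y ∈ Ω, ContDiffAt ℝ (⊤ : ℕ∞) u y := fun y hy => hu.contDiffAt (hΩ.mem_nhds hy)
  have hDu : ContDiffOn ℝ 1 (fderiv ℝ u) Ω := hu.fderiv_of_isOpen hΩ (by norm_cast)
  have hDuc : ContinuousOn (fderiv ℝ u) (closedBall x r) := hDu.continuousOn.mono hball
  have huc : ContinuousOn u (closedBall x r) := hu.continuousOn.mono hball
  have hu1 : ContDiffOn ℝ 1 u Ω := hu.of_le (by norm_cast)
  have hsubs : closedBall x r \ {x} ⊆ closedBall x r := Set.diff_subset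
  have hinv : ContinuousOn (fun y : EuclideanSpace ℝ (Fin m) => ‖y - x‖⁻¹) (closedBall x r \ {x}) := by
    apply ContinuousOn.inv₀ (by fun_prop)
    intro y hy
    exact norm_ne_zero_iff.2 (sub_ne_zero.2 hy.2)
  have hν : ContinuousOn (fun y => fderiv ℝ u y (‖y - x‖⁻¹ • (y - x))) (closedBall x r \ {x}) :=
    (hDuc.mono hsubs).clm_apply (hinv.smul (by fun_prop))
  let e : Fin m → EuclideanSpace ℝ (Fin m) := fun i => EuclideanSpace.single i 1
  let G : Fin m → EuclideanSpace ℝ (Fin m) → ℝ := fun i y => inner ℝ (fderiv ℝ u y (e i)) (u y)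
  have hG : ∀ i, ContDiffOn ℝ 1 (G i) Ω := fun i =>
    (hDu.clm_apply contDiffOn_const).inner ℝ hu1
  let C : ℝ := - ∫ y, inner ℝ (fderiv ℝ u y (‖y - x‖⁻¹ • (y - x))) (u y) * deriv φ (‖y - x‖ / r)
  have hdG : ∀ i, ∀ y ∈ Ω, fderiv ℝ (G i) y (e i) =
      ‖fderiv ℝ u y (e i)‖ ^ 2 + inner ℝ (iteratedFDeriv ℝ 2 u y ![e i, e i]) (u y) := by
    intro i y hy
    have h1 : HasFDerivAt u (fderiv ℝ u y) y :=
      ((hu1.contDiffAt (hΩ.mem_nhds hy)).differentiableAt (by simp)).hasFDerivAt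
    have h2 : HasFDerivAt (fderiv ℝ u) (fderiv ℝ (fderiv ℝ u) y) y :=
      ((hDu.contDiffAt (hΩ.mem_nhds hy)).differentiableAt (by simp)).hasFDerivAt
    have h3 := (h2.clm_apply (hasFDerivAt_const (e i) y)).inner ℝ h1
    have h4 := h3.fderiv
    change fderiv ℝ (G i) y = _ at h4
    rw [h4, iteratedFDeriv_two_apply]
    simp [fderivInnerCLM_apply]
  have hint1 : ∀ i, Integrable (fun y => (r⁻¹ * (‖y - x‖⁻¹ * inner ℝ (y - x) (e i)) * G i y) *
      deriv φ (‖y - x‖ / r)) := by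
    intro i
    apply aux_integrable φ K hlip hmono hone hzero hrange x r hr
    exact (continuousOn_const.mul (hinv.mul (by fun_prop))).mul
      (((hG i).continuousOn.mono hball).mono hsubs)
  have hint2 : ∀ i, Integrable (fun y => fderiv ℝ (G i) y (e i) * φ (‖y - x‖ / r)) := by
    intro i
    apply aux_integrable' φ K hlip hzero x r hr
    exact (((hG i).continuousOn_fderiv_of_isOpen hΩ (by simp)).mono hball).clm_apply
      continuousOn_const
  have hparts : C = r * ∫ y, ∑ i, fderiv ℝ (G i) y (e i) * φ (‖y - x‖ / r) := by
    rw [integral_finset_sum _ (fun i _ => hint2 i)]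
    have h1 : ∀ i, ∫ y, fderiv ℝ (G i) y (e i) * φ (‖y - x‖ / r) =
      - ∫ y, (r⁻¹ * (‖y - x‖⁻¹ * inner ℝ (y - x) (e i)) * G i y) * deriv φ (‖y - x‖ / r) := by
      intro i
      rw [aux_parts φ K hlip hmono hone hzero hrange Ω hΩ x r hr hball (G i) (hG i) (e i), neg_neg]
    simp only [h1]
    rw [Finset.sum_neg_distrib, ← integral_finset_sum _ (fun i _ => hint1 i), mul_neg,
      ← integral_const_mul]
    simp only [C]
    congr 2
    ext y
    have h2 : ‖y - x‖⁻¹ • (y - x) = ∑ i, (‖y - x‖⁻¹ * inner ℝ (y - x) (e i)) • e i := by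
      ext j
      simp [e, Pi.single_apply, EuclideanSpace.inner_single_right]
    conv_lhs => rw [h2]
    rw [map_sum, sum_inner, Finset.sum_mul, Finset.mul_sum]
    refine Finset.sum_congr rfl fun i _ => ?_
    rw [map_smul, inner_smul_left]
    simp only [G, conj_trivial]
    field_simp
  have hDC : r * D ≤ C := by
    rw [hparts, hD]
    apply mul_le_mul_of_nonneg_left _ hr.le
    apply integral_mono
    · exact aux_integrable' φ K hlip hzero x r hr _ (hDuc.norm.pow 2)
    · exact integrable_finset_sum _ (fun i _ => hint2 i)
    intro y
    change ‖fderiv ℝ u y‖ ^ 2 * φ (‖y - x‖ / r) ≤ ∑ i, fderiv ℝ (G i) y (e i) * φ (‖y - x‖ / r)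
    rcases lt_or_ge ‖y - x‖ r with h | h
    · have hy : y ∈ Ω := hball (by simpa [dist_eq_norm] using h.le)
      rw [← Finset.sum_mul]
      apply mul_le_mul_of_nonneg_right _ (hrange _).1
      rw [Finset.sum_congr rfl (fun i _ => hdG i y hy), Finset.sum_add_distrib, ← sum_inner,
        hharm y hy, inner_zero_left, add_zero]
      exact aux_opnorm _
    · simp [hzero _ ((one_le_div hr).2 h)]
  have hD0 : 0 ≤ r * D := by
    rw [hD]
    apply mul_nonneg hr.le
    apply integral_nonneg
    intro y
    exact mul_nonneg (by positivity) (hrange _).1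
  have hiH : Integrable (fun y => ‖u y‖ ^ 2 * ‖y - x‖⁻¹ * deriv φ (‖y - x‖ / r)) :=
    aux_integrable φ K hlip hmono hone hzero hrange x r hr _ (((huc.mono hsubs).norm.pow 2).mul hinv)
  have hiE : Integrable (fun y => ‖fderiv ℝ u y (‖y - x‖⁻¹ • (y - x))‖ ^ 2 * ‖y - x‖ *
      deriv φ (‖y - x‖ / r)) :=
    aux_integrable φ K hlip hmono hone hzero hrange x r hr _ ((hν.norm.pow 2).mul (by fun_prop))
  have hiC : Integrable (fun y => inner ℝ (fderiv ℝ u y (‖y - x‖⁻¹ • (y - x))) (u y) *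
      deriv φ (‖y - x‖ / r)) :=
    aux_integrable φ K hlip hmono hone hzero hrange x r hr _ (hν.inner (huc.mono hsubs))
  have hquad : ∀ s : ℝ, 0 ≤ H * (s * s) + (2 * C) * s + E := by
    intro s
    have h1 : H * (s * s) + (2 * C) * s + E = - ∫ y,
        ((s * s) * (‖u y‖ ^ 2 * ‖y - x‖⁻¹ * deriv φ (‖y - x‖ / r)) +
        (2 * s) * (inner ℝ (fderiv ℝ u y (‖y - x‖⁻¹ • (y - x))) (u y) * deriv φ (‖y - x‖ / r)) +
        ‖fderiv ℝ u y (‖y - x‖⁻¹ • (y - x))‖ ^ 2 * ‖y - x‖ * deriv φ (‖y - x‖ / r)) := by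
      have hadd := (hiH.const_mul (s * s)).add (hiC.const_mul (2 * s))
      simp only [Pi.add_def] at hadd
      rw [integral_add hadd hiE,
        integral_add (hiH.const_mul _) (hiC.const_mul _), integral_const_mul, integral_const_mul,
        hH, hE]
      simp only [C]
      ring
    rw [h1, neg_nonneg]
    apply integral_nonpos
    intro y
    by_cases hy : y = x
    · subst hy
      have := aux_deriv_low φ hmono hone hrange 0 (by norm_num)
      simp [this]
    · have hn : 0 < ‖y - x‖ := norm_pos_iff.2 (sub_ne_zero.2 hy)
      set a := fderiv ℝ u y (‖y - x‖⁻¹ • (y - x)) with ha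
      have h2 := norm_add_sq_real a ((s * ‖y - x‖⁻¹) • u y)
      rw [inner_smul_right, norm_smul, mul_pow, Real.norm_eq_abs, sq_abs] at h2
      have h3 : (s * s) * (‖u y‖ ^ 2 * ‖y - x‖⁻¹ * deriv φ (‖y - x‖ / r)) +
        (2 * s) * (inner ℝ a (u y) * deriv φ (‖y - x‖ / r)) +
        ‖a‖ ^ 2 * ‖y - x‖ * deriv φ (‖y - x‖ / r) =
        (‖y - x‖ * ‖a + (s * ‖y - x‖⁻¹) • u y‖ ^ 2) * deriv φ (‖y - x‖ / r) := by
        rw [h2]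
        generalize deriv φ (‖y - x‖ / r) = d
        field_simp
        ring
      refine le_trans (le_of_eq h3) ?_
      exact mul_nonpos_of_nonneg_of_nonpos (by positivity) hmono.deriv_nonpos
  have hdisc := discrim_le_zero hquad
  rw [discrim] at hdisc
  have : (r * D) ^ 2 ≤ C ^ 2 := by gcongr
  nlinarith
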